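/- arXiv:2305.14037 — 6 statements merged into one kernel-verified Lean document; each statement's English description precedes it below -/
import Mathlib

section
/- Let T ≥ 1, let σ > 0, let f_0 be a probability density on ℝ, and let μ, ν be probability measures on ℝ with densities and finite second moments, with ∫ |log f_0| dμ < ∞. Let γ_T be the probability density on ℝ^{T+1} of the Gaussian random walk started from f_0, i.e. γ_T(x_0,…,x_T) = f_0(x_0) ∏_{i=1}^T (2πσ²)^{−1/2} exp(−(x_i − x_{i−1})²/(2σ²)). Then for every martingale transport plan Q ∈ M_T(μ,ν) having a density q with respect to Lebesgue measure on ℝ^{T+1} and finite differential entropy, the relative entropy satisfies H(Q | γ_T · λ_{T+1}) = −H(Q) + (T/2)·log(2πσ²) − ∫ log f_0 dμ + (1/(2σ²))·(∫ x² dν(x) − ∫ x² dμ(x)), where H(Q) = −∫ q log q dλ_{T+1} is the differential (Shannon) entropy of Q. -/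
open MeasureTheory Real

/-- `Q` is a martingale transport plan on `ℝ^{T+1}` between `μ` and `ν`: it is a probability
measure under which the coordinate process is a martingale in its natural filtration, with
`X_0 ∼ μ` and `X_T ∼ ν`. -/
def IsMartingaleTransportPlan (T : ℕ) (μ ν : Measure ℝ)
    (Q : Measure (Fin (T + 1) → ℝ)) : Prop :=
  IsProbabilityMeasure Q ∧
  Martingale (fun (i : Fin (T + 1)) (ω : Fin (T + 1) → ℝ) => ω i)
    (Filtration.natural (fun (i : Fin (T + 1)) (ω : Fin (T + 1) → ℝ) => ω i)
      (fun i => (measurable_pi_apply i).stronglyMeasurable)) Q ∧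
  Q.map (fun ω => ω 0) = μ ∧ Q.map (fun ω => ω (Fin.last T)) = ν

/-- The density `γ_T` on `ℝ^{T+1}` of the Gaussian random walk with step variance `σ²`,
started from the density `f₀`:
`γ_T(x_0,…,x_T) = f₀(x_0) ∏_{i=1}^T (2πσ²)^{-1/2} exp(−(x_i − x_{i−1})²/(2σ²))`. -/
noncomputable def gaussianRW (T : ℕ) (σ : ℝ) (f₀ : ℝ → ℝ) (ω : Fin (T + 1) → ℝ) : ℝ :=
  f₀ (ω 0) * ∏ i : Fin T,
    (Real.sqrt (2 * π * σ ^ 2))⁻¹ * Real.exp (-(ω i.succ - ω i.castSucc) ^ 2 / (2 * σ ^ 2))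

/-- Square integrability propagates backwards in time along a martingale. -/
lemma MeasureTheory.Martingale.memLp_two_of_le {Ω ι : Type*} [Preorder ι] {m0 : MeasurableSpace Ω}
    {P : Measure Ω} {ℱ : Filtration ι m0} {X : ι → Ω → ℝ} (hX : Martingale X ℱ P)
    {i j : ι} (hij : i ≤ j) (hj : MemLp (X j) 2 P) : MemLp (X i) 2 P :=
  (hj.condExp (m := ℱ i) one_le_two).ae_eq (hX.condExp_ae_eq hij)

/-- The increments of a square integrable martingale are orthogonal to its past. -/
lemma MeasureTheory.Martingale.integral_mul_eq_integral_sq {Ω ι : Type*} [Preorder ι]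
    {m0 : MeasurableSpace Ω} {P : Measure Ω} [IsFiniteMeasure P] {ℱ : Filtration ι m0}
    {X : ι → Ω → ℝ} (hX : Martingale X ℱ P) {i j : ι} (hij : i ≤ j) (hj : MemLp (X j) 2 P) :
    ∫ ω, X i ω * X j ω ∂P = ∫ ω, X i ω ^ 2 ∂P := by
  have hprod : Integrable (X i * X j) P := (hX.memLp_two_of_le hij hj).integrable_mul hj
  have hpull : P[X i * X j | ℱ i] =ᵐ[P] X i * P[X j | ℱ i] :=
    condExp_mul_of_stronglyMeasurable_left (hX.stronglyMeasurable i) hprod (hX.integrable j)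
  calc ∫ ω, X i ω * X j ω ∂P = ∫ ω, (P[X i * X j | ℱ i]) ω ∂P :=
        (integral_condExp (ℱ.le i)).symm
    _ = ∫ ω, X i ω ^ 2 ∂P := by
        refine integral_congr_ae ?_
        filter_upwards [hpull, hX.condExp_ae_eq hij] with ω h₁ h₂
        rw [h₁, Pi.mul_apply, h₂, sq]

/-- The second moment of an increment of a square integrable martingale is the increment of the
second moments. -/
lemma MeasureTheory.Martingale.integral_sub_sq {Ω ι : Type*} [Preorder ι]
    {m0 : MeasurableSpace Ω} {P : Measure Ω} [IsFiniteMeasure P] {ℱ : Filtration ι m0}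
    {X : ι → Ω → ℝ} (hX : Martingale X ℱ P) {i j : ι} (hij : i ≤ j) (hj : MemLp (X j) 2 P) :
    ∫ ω, (X j ω - X i ω) ^ 2 ∂P = (∫ ω, X j ω ^ 2 ∂P) - ∫ ω, X i ω ^ 2 ∂P := by
  have hi := hX.memLp_two_of_le hij hj
  have hprod : Integrable (fun ω => 2 * (X i ω * X j ω)) P :=
    (hi.integrable_mul hj).const_mul 2
  have hexp : ∀ ω, (X j ω - X i ω) ^ 2 = X j ω ^ 2 - 2 * (X i ω * X j ω) + X i ω ^ 2 :=
    fun ω => by ring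
  have hdiff : Integrable (fun ω => X j ω ^ 2 - 2 * (X i ω * X j ω)) P :=
    hj.integrable_sq.sub hprod
  simp_rw [hexp]
  rw [integral_add hdiff hi.integrable_sq,
    integral_sub hj.integrable_sq hprod, integral_const_mul,
    hX.integral_mul_eq_integral_sq hij hj]
  ring

lemma Fin.sum_succ_sub_castSucc {G : Type*} [AddCommGroup G] {n : ℕ} (a : Fin (n + 1) → G) :
    ∑ i : Fin n, (a i.succ - a i.castSucc) = a (Fin.last n) - a 0 := by
  rw [Finset.sum_sub_distrib, sub_eq_sub_iff_add_eq_add, add_comm, ← Fin.sum_univ_succ,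
    Fin.sum_univ_castSucc, add_comm]

lemma gaussianRW_pos {T : ℕ} {σ : ℝ} (hσ : 0 < σ) {f₀ : ℝ → ℝ} {ω : Fin (T + 1) → ℝ}
    (h : 0 < f₀ (ω 0)) : 0 < gaussianRW T σ f₀ ω := by
  unfold gaussianRW
  positivity

lemma log_gaussianRW {T : ℕ} {σ : ℝ} (hσ : 0 < σ) {f₀ : ℝ → ℝ} {ω : Fin (T + 1) → ℝ}
    (h : 0 < f₀ (ω 0)) :
    Real.log (gaussianRW T σ f₀ ω) = Real.log (f₀ (ω 0)) - (T : ℝ) / 2 * Real.log (2 * π * σ ^ 2)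
      - 1 / (2 * σ ^ 2) * ∑ i : Fin T, (ω i.succ - ω i.castSucc) ^ 2 := by
  have hs : 0 < Real.sqrt (2 * π * σ ^ 2) := by positivity
  have hterm : ∀ i : Fin T, Real.log ((Real.sqrt (2 * π * σ ^ 2))⁻¹ *
      Real.exp (-(ω i.succ - ω i.castSucc) ^ 2 / (2 * σ ^ 2))) =
      -(Real.log (2 * π * σ ^ 2) / 2)
        - 1 / (2 * σ ^ 2) * (ω i.succ - ω i.castSucc) ^ 2 := by
    intro i
    rw [Real.log_mul (inv_pos.2 hs).ne' (Real.exp_pos _).ne', Real.log_inv, Real.log_exp,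
      Real.log_sqrt (by positivity)]
    ring
  rw [gaussianRW, Real.log_mul h.ne' (Finset.prod_pos fun i _ => by positivity).ne',
    Real.log_prod fun i _ => by positivity, Finset.sum_congr rfl fun i _ => hterm i,
    Finset.sum_sub_distrib, ← Finset.mul_sum, Finset.sum_const, Finset.card_univ,
    Fintype.card_fin, nsmul_eq_mul]
  ring

/-- for a martingale transport plan `Q = q·λ` with finite differential entropy,
the relative entropy with respect to the Gaussian random walk `γ_T·λ` (computed via densities
as `∫ log(q/γ_T) dQ`) satisfies
`H(Q|γ_T·λ) = −H(Q) + (T/2) log(2πσ²) − ∫ log f₀ dμ + (1/(2σ²))(∫ x² dν − ∫ x² dμ)`,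
where `H(Q) = −∫ q log q dλ`. -/
theorem relative_entropy_formula (T : ℕ) (hT : 1 ≤ T) (σ : ℝ) (hσ : 0 < σ)
    (f₀ : ℝ → ℝ) (hf₀m : Measurable f₀) (hf₀nn : ∀ x, 0 ≤ f₀ x)
    (hf₀i : (∫ x, f₀ x) = 1)
    (μ ν : Measure ℝ) [IsProbabilityMeasure μ] [IsProbabilityMeasure ν]
    (hμac : μ ≪ (volume : Measure ℝ)) (hνac : ν ≪ (volume : Measure ℝ))
    (hμ2 : Integrable (fun x : ℝ => x ^ 2) μ) (hν2 : Integrable (fun x : ℝ => x ^ 2) ν)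
    (hf₀pos : ∀ᵐ x ∂μ, 0 < f₀ x)
    (hlogf₀ : Integrable (fun x => Real.log (f₀ x)) μ)
    (Q : Measure (Fin (T + 1) → ℝ)) (hQ : IsMartingaleTransportPlan T μ ν Q)
    (q : (Fin (T + 1) → ℝ) → ℝ) (hqnn : ∀ ω, 0 ≤ q ω) (hqm : Measurable q)
    (hQq : Q = (volume : Measure (Fin (T + 1) → ℝ)).withDensity (fun ω => ENNReal.ofReal (q ω)))
    (hent : Integrable (fun ω => q ω * Real.log (q ω))
      (volume : Measure (Fin (T + 1) → ℝ))) :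
    ∫ ω, Real.log (q ω / gaussianRW T σ f₀ ω) ∂Q
      = (∫ ω, q ω * Real.log (q ω)) + ((T : ℝ) / 2) * Real.log (2 * π * σ ^ 2)
        - (∫ x, Real.log (f₀ x) ∂μ)
        + (1 / (2 * σ ^ 2)) * ((∫ x, x ^ 2 ∂ν) - ∫ x, x ^ 2 ∂μ) := by
  obtain ⟨hprob, hmart, h0, hlast⟩ := hQ
  have hX0 : Measurable fun ω : Fin (T + 1) → ℝ => ω 0 := measurable_pi_apply 0
  have hXT : Measurable fun ω : Fin (T + 1) → ℝ => ω (Fin.last T) :=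
    measurable_pi_apply (Fin.last T)
  have hMT : MemLp (fun ω : Fin (T + 1) → ℝ => ω (Fin.last T)) 2 Q := by
    rw [memLp_two_iff_integrable_sq hXT.aestronglyMeasurable]
    rw [← hlast] at hν2
    exact hν2.comp_measurable hXT
  have hM : ∀ i : Fin (T + 1), MemLp (fun ω : Fin (T + 1) → ℝ => ω i) 2 Q :=
    fun i => hmart.memLp_two_of_le (Fin.le_last i) hMT
  have hsq : ∀ i : Fin T,
      Integrable (fun ω : Fin (T + 1) → ℝ => (ω i.succ - ω i.castSucc) ^ 2) Q :=
    fun i => ((hM i.succ).sub (hM i.castSucc)).integrable_sq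
  have hqpos : ∀ᵐ ω ∂Q, 0 < q ω := by
    rw [hQq, ae_withDensity_iff hqm.ennreal_ofReal]
    exact .of_forall fun ω hω => by simpa using hω
  have hfpos : ∀ᵐ ω ∂Q, 0 < f₀ (ω 0) := by
    rw [← h0] at hf₀pos
    exact ae_of_ae_map hX0.aemeasurable hf₀pos
  have hlogq : Integrable (fun ω => Real.log (q ω)) Q := by
    rw [hQq, integrable_withDensity_iff_integrable_smul' hqm.ennreal_ofReal (by simp)]
    simpa only [ENNReal.toReal_ofReal (hqnn _), smul_eq_mul] using hent
  have hintq : ∫ ω, Real.log (q ω) ∂Q = ∫ ω, q ω * Real.log (q ω) := by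
    rw [hQq, integral_withDensity_eq_integral_toReal_smul hqm.ennreal_ofReal (by simp)]
    simp only [ENNReal.toReal_ofReal (hqnn _), smul_eq_mul]
  have hlogf : Integrable (fun ω : Fin (T + 1) → ℝ => Real.log (f₀ (ω 0))) Q := by
    rw [← h0] at hlogf₀
    exact hlogf₀.comp_measurable hX0
  have hintf : ∫ ω, Real.log (f₀ (ω 0)) ∂Q = ∫ x, Real.log (f₀ x) ∂μ := by
    rw [← h0, integral_map hX0.aemeasurable (hf₀m.log.aestronglyMeasurable)]
  have hint0 : ∫ ω, ω 0 ^ 2 ∂Q = ∫ x, x ^ 2 ∂μ := by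
    rw [← h0, integral_map hX0.aemeasurable (by fun_prop)]
  have hintT : ∫ ω, ω (Fin.last T) ^ 2 ∂Q = ∫ x, x ^ 2 ∂ν := by
    rw [← hlast, integral_map hXT.aemeasurable (by fun_prop)]
  have hintsq : ∫ ω, ∑ i : Fin T, (ω i.succ - ω i.castSucc) ^ 2 ∂Q
      = (∫ x, x ^ 2 ∂ν) - ∫ x, x ^ 2 ∂μ := by
    rw [integral_finsetSum _ fun i _ => hsq i, ← hint0, ← hintT,
      ← Fin.sum_succ_sub_castSucc fun i : Fin (T + 1) => ∫ ω, ω i ^ 2 ∂Q]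
    exact Finset.sum_congr rfl fun i _ =>
      hmart.integral_sub_sq i.castSucc_lt_succ.le (hM i.succ)
  have hlog : (fun ω => Real.log (q ω / gaussianRW T σ f₀ ω)) =ᵐ[Q] fun ω =>
      Real.log (q ω) + (T : ℝ) / 2 * Real.log (2 * π * σ ^ 2) - Real.log (f₀ (ω 0))
        + 1 / (2 * σ ^ 2) * ∑ i : Fin T, (ω i.succ - ω i.castSucc) ^ 2 := by
    filter_upwards [hqpos, hfpos] with ω h₁ h₂
    rw [Real.log_div h₁.ne' (gaussianRW_pos hσ h₂).ne', log_gaussianRW hσ h₂]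
    ring
  have hconst := integrable_const (μ := Q) ((T : ℝ) / 2 * Real.log (2 * π * σ ^ 2))
  have hadd : Integrable
      (fun ω => Real.log (q ω) + (T : ℝ) / 2 * Real.log (2 * π * σ ^ 2)) Q := hlogq.add hconst
  have hsub : Integrable (fun ω =>
      Real.log (q ω) + (T : ℝ) / 2 * Real.log (2 * π * σ ^ 2) - Real.log (f₀ (ω 0))) Q :=
    hadd.sub hlogf
  rw [integral_congr_ae hlog,
    integral_add hsub ((integrable_finsetSum _ fun i _ => hsq i).const_mul _),
    integral_sub hadd hlogf, integral_add hlogq hconst, integral_const,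
    probReal_univ, one_smul, integral_const_mul, hintq, hintf, hintsq]
end

section
/- Define f : (0,1) × (0,1) → ℝ by f(t,x) = log( sin(πx) / (π·√(1−t)) ). Then for all (t,x) ∈ (0,1) × (0,1), ∂_t f(t,x) + ( sin²(πx) / (2π²(1−t)) ) · ∂²_{xx} f(t,x) = 0. Equivalently, the function σ̄(t,x) = sin(πx)/(π√(1−t)) satisfies the PDE (∂_t + (σ̄²/2)·∂²_{xx}) log σ̄ = 0 suggested by Aldous. -/
open Real

theorem hasDerivAt_log_sin_pi_mul_div {c y : ℝ} (hc : c ≠ 0) (hy : Real.sin (π * y) ≠ 0) :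
    HasDerivAt (fun y : ℝ => Real.log (Real.sin (π * y) / c))
      (π * Real.cos (π * y) / Real.sin (π * y)) y := by
  have h : HasDerivAt (fun y : ℝ => π * y) π y := by
    simpa using (hasDerivAt_id y).const_mul π
  convert (h.sin.div_const c).log (div_ne_zero hy hc) using 1
  field_simp

theorem hasDerivAt_pi_mul_cos_div_sin {y : ℝ} (hy : Real.sin (π * y) ≠ 0) :
    HasDerivAt (fun y : ℝ => π * Real.cos (π * y) / Real.sin (π * y))
      (-(π ^ 2 / Real.sin (π * y) ^ 2)) y := by
  have h : HasDerivAt (fun y : ℝ => π * y) π y := by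
    simpa using (hasDerivAt_id y).const_mul π
  refine ((h.cos.const_mul π).div h.sin hy).congr_deriv ?_
  field_simp
  linear_combination -Real.sin_sq_add_cos_sq (π * y)

theorem hasDerivAt_log_div_mul_sqrt_one_sub {a b t : ℝ} (ha : a ≠ 0) (hb : b ≠ 0) (ht : t < 1) :
    HasDerivAt (fun s : ℝ => Real.log (a / (b * Real.sqrt (1 - s)))) (1 / (2 * (1 - t))) t := by
  have hpos : 0 < 1 - t := sub_pos.mpr ht
  have hs : Real.sqrt (1 - t) ≠ 0 := (Real.sqrt_pos.mpr hpos).ne'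
  have h : HasDerivAt (fun s : ℝ => 1 - s) (-1) t := by
    simpa using (hasDerivAt_id t).const_sub 1
  have hbs := mul_ne_zero hb hs
  refine (((hasDerivAt_const t a).div ((h.sqrt hpos.ne').const_mul b) hbs).log
    (div_ne_zero ha hbs)).congr_deriv ?_
  have hsq := Real.sq_sqrt hpos.le
  simp only [Pi.div_apply]
  field_simp
  linear_combination (-a) * hsq

/-- The function `f(t,x) = log(sin(πx)/(π√(1−t)))` satisfies Aldous' PDE
`∂ₜ f + (sin²(πx)/(2π²(1−t))) ∂²ₓₓ f = 0` on `(0,1) × (0,1)`. -/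
theorem aldous_pde (t x : ℝ) (ht : t ∈ Set.Ioo (0 : ℝ) 1) (hx : x ∈ Set.Ioo (0 : ℝ) 1) :
    deriv (fun s : ℝ => Real.log (Real.sin (π * x) / (π * Real.sqrt (1 - s)))) t
      + Real.sin (π * x) ^ 2 / (2 * π ^ 2 * (1 - t)) *
        deriv (deriv (fun y : ℝ => Real.log (Real.sin (π * y) / (π * Real.sqrt (1 - t))))) x
      = 0 := by
  have hpos : 0 < 1 - t := sub_pos.mpr ht.2
  have hsin : Real.sin (π * x) ≠ 0 :=
    (Real.sin_pos_of_pos_of_lt_pi (mul_pos Real.pi_pos hx.1)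
      (mul_lt_of_lt_one_right Real.pi_pos hx.2)).ne'
  have hc : π * Real.sqrt (1 - t) ≠ 0 := (mul_pos Real.pi_pos (Real.sqrt_pos.mpr hpos)).ne'
  have hcont : ContinuousAt (fun y : ℝ => Real.sin (π * y)) x := by fun_prop
  have hev : deriv (fun y : ℝ => Real.log (Real.sin (π * y) / (π * Real.sqrt (1 - t))))
      =ᶠ[nhds x] fun y => π * Real.cos (π * y) / Real.sin (π * y) := by
    filter_upwards [hcont.eventually_ne hsin] with y hy
    exact (hasDerivAt_log_sin_pi_mul_div hc hy).deriv
  rw [hev.deriv_eq, (hasDerivAt_pi_mul_cos_div_sin hsin).deriv,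
    (hasDerivAt_log_div_mul_sqrt_one_sub hsin Real.pi_ne_zero ht.2).deriv]
  have hne := hpos.ne'
  field_simp
  ring
end

section
/- Let σ : (0,1) → (0,∞) be twice continuously differentiable, and define σ̂(t,x) = σ(x)/√(1−t) on (0,1) × (0,1). If the function (t,x) ↦ log σ̂(t,x) satisfies ∂_t log σ̂(t,x) + (σ̂(t,x)²/2)·∂²_{xx} log σ̂(t,x) = 0 for all (t,x) ∈ (0,1) × (0,1), then σ satisfies the ordinary differential equation σ''(x)·σ(x) − (σ'(x))² = −1 for all x ∈ (0,1). -/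
open Real

theorem hasDerivAt_log_div_sqrt_one_sub {c t : ℝ} (hc : 0 < c) (ht : t < 1) :
    HasDerivAt (fun s : ℝ => Real.log (c / Real.sqrt (1 - s))) (1 / (2 * (1 - t))) t := by
  have h1 : 0 < 1 - t := sub_pos.mpr ht
  have hd : HasDerivAt (fun s : ℝ => Real.log c - Real.log (1 - s) / 2)
      (1 / (2 * (1 - t))) t := by
    refine (((((hasDerivAt_id' t).const_sub 1).log h1.ne').div_const 2).const_sub
      (Real.log c)).congr_deriv ?_
    field_simp
  refine hd.congr_of_eventuallyEq ?_
  filter_upwards [Iio_mem_nhds ht] with s hs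
  have hs' : 0 < 1 - s := sub_pos.mpr hs
  rw [Real.log_div hc.ne' (Real.sqrt_pos.mpr hs').ne', Real.log_sqrt hs'.le]

theorem deriv_deriv_log_div_const {f : ℝ → ℝ} {U : Set ℝ} (hU : IsOpen U)
    (hf : ContDiffOn ℝ 2 f U) (hpos : ∀ x ∈ U, 0 < f x) {c : ℝ} (hc : c ≠ 0) {x : ℝ}
    (hx : x ∈ U) :
    deriv (deriv (fun y : ℝ => Real.log (f y / c))) x =
      (deriv (deriv f) x * f x - (deriv f x) ^ 2) / f x ^ 2 := by
  have hd : ∀ y ∈ U, HasDerivAt f (deriv f y) y := fun y hy =>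
    ((hf.differentiableOn (by norm_num)).differentiableAt (hU.mem_nhds hy)).hasDerivAt
  have hd2 : HasDerivAt (deriv f) (deriv (deriv f) x) x :=
    (((hf.deriv_of_isOpen (m := 1) hU (by norm_num)).differentiableOn
      (by norm_num)).differentiableAt (hU.mem_nhds hx)).hasDerivAt
  have heq : deriv (fun y : ℝ => Real.log (f y / c)) =ᶠ[nhds x] fun y => deriv f y / f y := by
    filter_upwards [hU.mem_nhds hx] with y hy
    have hy0 := (hpos y hy).ne'
    rw [(((hd y hy).div_const c).log (div_ne_zero hy0 hc)).deriv]
    field_simp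
  rw [heq.deriv_eq, sq (deriv f x)]
  exact (hd2.div (hd x hx) (hpos x hx).ne').deriv

/-- If `σ : (0,1) → (0,∞)` is C² and `σ̂(t,x) = σ(x)/√(1−t)` is such that
`log σ̂` solves Aldous' PDE `∂ₜ log σ̂ + (σ̂²/2) ∂²ₓₓ log σ̂ = 0` on `(0,1) × (0,1)`, then
`σ'' σ − (σ')² = −1` on `(0,1)`. -/
theorem scaling_reduction (σ : ℝ → ℝ) (hσC : ContDiffOn ℝ 2 σ (Set.Ioo (0 : ℝ) 1))
    (hσpos : ∀ x ∈ Set.Ioo (0 : ℝ) 1, 0 < σ x)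
    (hPDE : ∀ t ∈ Set.Ioo (0 : ℝ) 1, ∀ x ∈ Set.Ioo (0 : ℝ) 1,
      deriv (fun s : ℝ => Real.log (σ x / Real.sqrt (1 - s))) t
        + (σ x / Real.sqrt (1 - t)) ^ 2 / 2 *
          deriv (deriv (fun y : ℝ => Real.log (σ y / Real.sqrt (1 - t)))) x = 0) :
    ∀ x ∈ Set.Ioo (0 : ℝ) 1, deriv (deriv σ) x * σ x - (deriv σ x) ^ 2 = -1 := by
  intro x hx
  have hp := hσpos x hx
  have h := hPDE (1 / 2) (by norm_num) x hx
  rw [(hasDerivAt_log_div_sqrt_one_sub hp (by norm_num)).deriv,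
    deriv_deriv_log_div_const isOpen_Ioo hσC hσpos (Real.sqrt_pos.mpr (by norm_num)).ne' hx,
    div_pow, Real.sq_sqrt (by norm_num)] at h
  field_simp at h
  linarith
end

section
/- Define v̄(s,x) = (x − x² − 1 + s)/2 − (1−s)·log( sin(πx)/(π√(1−s)) ) for s ∈ [0,1), x ∈ (0,1). For each (t,x) ∈ (0,1) × (0,1), the value Σ̄ = sin²(πx)/(π²(1−t)) is the unique minimizer on (0,∞) of the function Σ ↦ Σ·∂²_{xx} v̄(t,x) + Σ − log Σ; that is, this function attains its minimum at Σ̄ and is strictly larger at every other Σ ∈ (0,∞). -/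
open Real

/-- The value function of the Aldous martingale:
`v̄(s,x) = (x − x² − 1 + s)/2 − (1−s) log(sin(πx)/(π√(1−s)))`. -/
noncomputable def vbar (s x : ℝ) : ℝ :=
  (x - x ^ 2 - 1 + s) / 2 - (1 - s) * Real.log (Real.sin (π * x) / (π * Real.sqrt (1 - s)))

theorem hasDerivAt_vbar {t y : ℝ} (ht : t < 1) (hy : y ∈ Set.Ioo (0 : ℝ) 1) :
    HasDerivAt (vbar t)
      ((1 - 2 * y) / 2 - (1 - t) * (π * Real.cos (π * y) / Real.sin (π * y))) y := by
  have hsin : 0 < Real.sin (π * y) :=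
    Real.sin_pos_of_pos_of_lt_pi (mul_pos pi_pos hy.1) (by nlinarith [pi_pos, hy.2])
  have hc : 0 < π * Real.sqrt (1 - t) := mul_pos pi_pos (Real.sqrt_pos.2 (by linarith))
  have hlin : HasDerivAt (fun z : ℝ => π * z) π y := by
    simpa using (hasDerivAt_id y).const_mul π
  have hlog := (hlin.sin.div_const (π * Real.sqrt (1 - t))).log (div_pos hsin hc).ne'
  have hquad := (hasDerivAt_id y).sub ((hasDerivAt_id y).pow 2)
  have hpoly := ((hquad.sub_const 1).add_const t).div_const 2
  refine (hpoly.sub (hlog.const_mul (1 - t))).congr_deriv ?_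
  rw [div_div_div_cancel_right₀ hc.ne']
  simp only [id, Nat.cast_ofNat]
  ring

theorem deriv_deriv_vbar {t x : ℝ} (ht : t < 1) (hx : x ∈ Set.Ioo (0 : ℝ) 1) :
    deriv (deriv (vbar t)) x = -1 + π ^ 2 * (1 - t) / Real.sin (π * x) ^ 2 := by
  have hsin : 0 < Real.sin (π * x) :=
    Real.sin_pos_of_pos_of_lt_pi (mul_pos pi_pos hx.1) (by nlinarith [pi_pos, hx.2])
  have hfirst : deriv (vbar t) =ᶠ[nhds x] fun y =>
      (1 - 2 * y) / 2 - (1 - t) * (π * Real.cos (π * y) / Real.sin (π * y)) := by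
    filter_upwards [isOpen_Ioo.mem_nhds hx] with y hy using (hasDerivAt_vbar ht hy).deriv
  rw [hfirst.deriv_eq]
  have hlin : HasDerivAt (fun z : ℝ => π * z) π x := by
    simpa using (hasDerivAt_id x).const_mul π
  have hpoly := (((hasDerivAt_id x).const_mul 2).const_sub 1).div_const 2
  have hcot := ((hlin.cos.const_mul π).div hlin.sin hsin.ne').const_mul (1 - t)
  refine ((hpoly.sub hcot).congr_deriv ?_).deriv
  field_simp
  linear_combination (1 - t) * π ^ 2 * Real.sin_sq_add_cos_sq (π * x)

theorem one_sub_log_lt_div_sub_log {a S : ℝ} (ha : 0 < a) (hS : 0 < S) (hne : S ≠ a) :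
    1 - Real.log a < S / a - Real.log S := by
  have h := Real.log_lt_sub_one_of_pos (div_pos hS ha) (by rwa [Ne, div_eq_one_iff_eq ha.ne'])
  rw [Real.log_div hS.ne' ha.ne'] at h
  linarith

/-- `Σ̄ = sin²(πx)/(π²(1−t))` is the unique minimizer on `(0,∞)` of
`Σ ↦ Σ ∂²ₓₓ v̄(t,x) + Σ − log Σ`: the function attains its minimum at `Σ̄` and is strictly
larger at every other `Σ ∈ (0,∞)`. -/
theorem unique_minimizer (t x : ℝ) (ht : t ∈ Set.Ioo (0 : ℝ) 1)
    (hx : x ∈ Set.Ioo (0 : ℝ) 1) :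
    ∀ S ∈ Set.Ioi (0 : ℝ),
      (Real.sin (π * x) ^ 2 / (π ^ 2 * (1 - t))) * deriv (deriv (vbar t)) x
          + Real.sin (π * x) ^ 2 / (π ^ 2 * (1 - t))
          - Real.log (Real.sin (π * x) ^ 2 / (π ^ 2 * (1 - t)))
        ≤ S * deriv (deriv (vbar t)) x + S - Real.log S
      ∧ (S ≠ Real.sin (π * x) ^ 2 / (π ^ 2 * (1 - t)) →
          (Real.sin (π * x) ^ 2 / (π ^ 2 * (1 - t))) * deriv (deriv (vbar t)) x
              + Real.sin (π * x) ^ 2 / (π ^ 2 * (1 - t))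
              - Real.log (Real.sin (π * x) ^ 2 / (π ^ 2 * (1 - t)))
            < S * deriv (deriv (vbar t)) x + S - Real.log S) := by
  intro S hS
  have hsin : 0 < Real.sin (π * x) :=
    Real.sin_pos_of_pos_of_lt_pi (mul_pos pi_pos hx.1) (by nlinarith [pi_pos, hx.2])
  have ht' : 0 < 1 - t := by linarith [ht.2]
  have hd : deriv (deriv (vbar t)) x = -1 + (Real.sin (π * x) ^ 2 / (π ^ 2 * (1 - t)))⁻¹ := by
    rw [deriv_deriv_vbar ht.2 hx, inv_div]
  have ha : 0 < Real.sin (π * x) ^ 2 / (π ^ 2 * (1 - t)) := by positivity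
  rw [hd]
  generalize Real.sin (π * x) ^ 2 / (π ^ 2 * (1 - t)) = a at ha ⊢
  have hlt : S ≠ a → a * (-1 + a⁻¹) + a - Real.log a < S * (-1 + a⁻¹) + S - Real.log S := by
    intro hne
    have h := one_sub_log_lt_div_sub_log ha hS hne
    rw [div_eq_mul_inv] at h
    linarith [mul_inv_cancel₀ ha.ne']
  refine ⟨?_, hlt⟩
  rcases eq_or_ne S a with rfl | hne
  · exact le_rfl
  · exact (hlt hne).le
end

section
/- Define v̄(s,x) = (x − x² − 1 + s)/2 − (1−s)·log( sin(πx)/(π√(1−s)) ) for s ∈ [0,1), x ∈ (0,1). Then v̄ satisfies the Hamilton–Jacobi–Bellman equation ∂_t v̄(t,x) + (1/2)·inf_{Σ ∈ (0,∞)} { Σ·∂²_{xx} v̄(t,x) + Σ − log Σ − 1 } = 0 for all (t,x) ∈ (0,1) × (0,1). -/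
open Real

theorem sin_pi_mul_pos {x : ℝ} (hx : x ∈ Set.Ioo (0 : ℝ) 1) : 0 < Real.sin (π * x) :=
  Real.sin_pos_of_pos_of_lt_pi (mul_pos pi_pos hx.1) (by nlinarith [pi_pos, hx.2])

theorem log_div_pi_mul_sqrt {a r : ℝ} (ha : 0 < a) (hr : 0 < r) :
    Real.log (a / (π * Real.sqrt r)) = Real.log a - Real.log π - Real.log r / 2 := by
  rw [Real.log_div ha.ne' (mul_pos pi_pos (Real.sqrt_pos.2 hr)).ne',
    Real.log_mul pi_ne_zero (Real.sqrt_pos.2 hr).ne', Real.log_sqrt hr.le]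
  ring

theorem vbar_eq {s x : ℝ} (hs : s < 1) (hx : x ∈ Set.Ioo (0 : ℝ) 1) :
    vbar s x = (x - x ^ 2 - 1 + s) / 2
      - (1 - s) * (Real.log (Real.sin (π * x)) - Real.log π - Real.log (1 - s) / 2) := by
  rw [vbar, log_div_pi_mul_sqrt (sin_pi_mul_pos hx) (sub_pos.2 hs)]

theorem hasDerivAt_vbar_time {t x : ℝ} (ht : t < 1) (hx : x ∈ Set.Ioo (0 : ℝ) 1) :
    HasDerivAt (fun s : ℝ => vbar s x)
      (Real.log (Real.sin (π * x)) - Real.log π - Real.log (1 - t) / 2) t := by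
  have h_pos : 0 < 1 - t := sub_pos.2 ht
  have h_sub : HasDerivAt (fun s : ℝ => 1 - s) (-1) t := by
    simpa using (hasDerivAt_id t).const_sub 1
  have h_log := h_sub.log h_pos.ne'
  have h_main := (((hasDerivAt_id t).const_add (x - x ^ 2 - 1)).div_const 2).sub
    (h_sub.mul ((h_log.div_const 2).const_sub (Real.log (Real.sin (π * x)) - Real.log π)))
  refine (h_main.congr_deriv ?_).congr_of_eventuallyEq ?_
  · field_simp
    ring
  · filter_upwards [Iio_mem_nhds ht] with s hs
    exact vbar_eq hs hx

theorem hasDerivAt_vbar_space {t x : ℝ} (ht : t < 1) (hx : x ∈ Set.Ioo (0 : ℝ) 1) :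
    HasDerivAt (vbar t)
      ((1 - 2 * x) / 2 - (1 - t) * (Real.cos (π * x) * π / Real.sin (π * x))) x := by
  have h_sin : HasDerivAt (fun y : ℝ => Real.sin (π * y)) (Real.cos (π * x) * π) x := by
    simpa using ((hasDerivAt_id x).const_mul π).sin
  have h_log := h_sin.log (sin_pi_mul_pos hx).ne'
  have h_main := (((((hasDerivAt_id x).sub (hasDerivAt_pow 2 x)).sub_const 1).add_const t).div_const
    2).sub (((h_log.sub_const (Real.log π)).sub_const (Real.log (1 - t) / 2)).const_mul (1 - t))
  refine (h_main.congr_deriv ?_).congr_of_eventuallyEq ?_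
  · norm_num
  · filter_upwards [Ioo_mem_nhds hx.1 hx.2] with y hy
    exact vbar_eq ht hy

theorem hasDerivAt_deriv_vbar_space {t x : ℝ} (ht : t < 1) (hx : x ∈ Set.Ioo (0 : ℝ) 1) :
    HasDerivAt (deriv (vbar t)) ((1 - t) * π ^ 2 / Real.sin (π * x) ^ 2 - 1) x := by
  have h_pos := sin_pi_mul_pos hx
  have h_lin : HasDerivAt (fun y : ℝ => π * y) π x := by
    simpa using (hasDerivAt_id x).const_mul π
  have h_main := ((((hasDerivAt_id x).const_mul 2).const_sub 1).div_const 2).sub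
    (((h_lin.cos.mul_const π).div h_lin.sin h_pos.ne').const_mul (1 - t))
  refine (h_main.congr_deriv ?_).congr_of_eventuallyEq ?_
  · field_simp
    linear_combination ((1 - t) * π ^ 2) * Real.sin_sq_add_cos_sq (π * x)
  · filter_upwards [Ioo_mem_nhds hx.1 hx.2] with y hy
    exact (hasDerivAt_vbar_space ht hy).deriv

theorem isLeast_mul_sub_log_sub_one {c : ℝ} (hc : 0 < c) :
    IsLeast ((fun S : ℝ => S * c - Real.log S - 1) '' Set.Ioi (0 : ℝ)) (Real.log c) := by
  refine ⟨⟨c⁻¹, inv_pos.2 hc, ?_⟩, ?_⟩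
  · simp [hc.ne']
  · rintro _ ⟨S, hS, rfl⟩
    have h_le := Real.log_le_sub_one_of_pos (mul_pos hS hc)
    rw [Real.log_mul (ne_of_gt hS) hc.ne'] at h_le
    dsimp only
    linarith

/-- `v̄` satisfies the HJB equation
`∂ₜ v̄(t,x) + (1/2) inf_{Σ ∈ (0,∞)} {Σ ∂²ₓₓ v̄(t,x) + Σ − log Σ − 1} = 0` on `(0,1) × (0,1)`. -/
theorem vbar_HJB (t x : ℝ) (ht : t ∈ Set.Ioo (0 : ℝ) 1) (hx : x ∈ Set.Ioo (0 : ℝ) 1) :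
    deriv (fun s : ℝ => vbar s x) t
      + (1 / 2) * sInf ((fun S : ℝ =>
          S * deriv (deriv (vbar t)) x + S - Real.log S - 1) '' Set.Ioi (0 : ℝ)) = 0 := by
  have h_sin := sin_pi_mul_pos hx
  have h_sub : 0 < 1 - t := sub_pos.2 ht.2
  have h_pos : 0 < (1 - t) * π ^ 2 / Real.sin (π * x) ^ 2 := by positivity
  have h_fun : (fun S : ℝ => S * ((1 - t) * π ^ 2 / Real.sin (π * x) ^ 2 - 1) + S
      - Real.log S - 1)
      = fun S : ℝ => S * ((1 - t) * π ^ 2 / Real.sin (π * x) ^ 2) - Real.log S - 1 := by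
    funext S
    ring
  rw [(hasDerivAt_vbar_time ht.2 hx).deriv, (hasDerivAt_deriv_vbar_space ht.2 hx).deriv, h_fun,
    (isLeast_mul_sub_log_sub_one h_pos).csInf_eq, Real.log_div (by positivity) (by positivity),
    Real.log_mul h_sub.ne' (by positivity), Real.log_pow, Real.log_pow]
  push_cast
  ring
end

section
/- Define v̄(s,x) = (x − x² − 1 + s)/2 − (1−s)·log( sin(πx)/(π√(1−s)) ) and ṽ(s,x) = (x − x² − 1 + s)/2 − (1−s)·log( √(x(1−x))/√(1−s) ) for s ∈ [0,1), x ∈ (0,1). Then there exists δ ∈ (0,∞) such that for all s ∈ [0,1) and x ∈ (0,1), |2·ṽ(s,x) − v̄(s,x)| ≤ |x − x² − 1 + s + (1−s)·log(1−s)|/2 + δ·(1−s). -/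
open Real

/-- The Jensen lower bound:
`ṽ(s,x) = (x − x² − 1 + s)/2 − (1−s) log(√(x(1−x))/√(1−s))`. -/
noncomputable def vtilde (s x : ℝ) : ℝ :=
  (x - x ^ 2 - 1 + s) / 2 - (1 - s) * Real.log (Real.sqrt (x * (1 - x)) / Real.sqrt (1 - s))

lemma sin_pi_mul_bounds {x : ℝ} (hx₀ : 0 < x) (hx₁ : x < 1) :
    2 * (x * (1 - x)) ≤ sin (π * x) ∧ sin (π * x) ≤ 2 * (π * (x * (1 - x))) := by
  have hpi := pi_pos
  have key : ∀ y : ℝ, 0 < y → y ≤ 1 / 2 →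
      2 * (y * (1 - y)) ≤ sin (π * y) ∧ sin (π * y) ≤ 2 * (π * (y * (1 - y))) := by
    intro y hy₀ hy₁
    have hlower : 2 / π * (π * y) ≤ sin (π * y) := mul_le_sin (by positivity) (by nlinarith)
    have hcancel : 2 / π * (π * y) = 2 * y := by field_simp
    have hupper : sin (π * y) ≤ π * y := sin_le (by positivity)
    have hprod : 0 ≤ π * y * (1 - 2 * y) := mul_nonneg (by positivity) (by linarith)
    constructor <;> nlinarith
  rcases le_total x (1 / 2) with h | h
  · exact key x hx₀ h
  · have hsymm := key (1 - x) (by linarith) (by linarith)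
    have hsin : sin (π * (1 - x)) = sin (π * x) := by
      rw [show π * (1 - x) = π - π * x by ring, sin_pi_sub]
    rw [hsin, sub_sub_cancel, mul_comm (1 - x) x] at hsymm
    exact hsymm

lemma abs_log_sub_log_sin_le {x : ℝ} (hx₀ : 0 < x) (hx₁ : x < 1) :
    |log (π * (x * (1 - x))) - log (sin (π * x))| ≤ log 2 := by
  have hq : 0 < x * (1 - x) := mul_pos hx₀ (sub_pos.mpr hx₁)
  have hp : 0 < π * (x * (1 - x)) := mul_pos pi_pos hq
  obtain ⟨hlower, hupper⟩ := sin_pi_mul_bounds hx₀ hx₁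
  have hsin : 0 < sin (π * x) := by linarith
  have hlog₁ := log_le_log hsin hupper
  have hlog₂ : log (π * (x * (1 - x))) ≤ log (2 * sin (π * x)) :=
    log_le_log hp (by nlinarith [pi_le_four])
  rw [log_mul two_ne_zero hp.ne'] at hlog₁
  rw [log_mul two_ne_zero hsin.ne'] at hlog₂
  rw [abs_le]
  constructor <;> linarith

lemma two_vtilde_sub_vbar_eq {s x : ℝ} (hs : s < 1) (hx₀ : 0 < x) (hx₁ : x < 1) :
    2 * vtilde s x - vbar s x =
      (x - x ^ 2 - 1 + s + (1 - s) * log (1 - s)) / 2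
        - (1 - s) * (log (π * (x * (1 - x))) - log (sin (π * x))) := by
  have hs' : 0 < 1 - s := sub_pos.mpr hs
  have hq : 0 < x * (1 - x) := mul_pos hx₀ (sub_pos.mpr hx₁)
  have hsin : 0 < sin (π * x) := by
    linarith [(sin_pi_mul_bounds hx₀ hx₁).1]
  have hsqrt := sqrt_pos.mpr hs'
  unfold vtilde vbar
  rw [log_div (sqrt_pos.mpr hq).ne' hsqrt.ne', log_div hsin.ne' (mul_pos pi_pos hsqrt).ne',
    log_mul pi_ne_zero hsqrt.ne', log_mul pi_ne_zero hq.ne', log_sqrt hs'.le, log_sqrt hq.le]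
  ring

/-- there is `δ ∈ (0,∞)` such that for all `s ∈ [0,1)`, `x ∈ (0,1)`,
`|2ṽ(s,x) − v̄(s,x)| ≤ |x − x² − 1 + s + (1−s) log(1−s)|/2 + δ(1−s)`. -/
theorem two_vtilde_sub_vbar_bound :
    ∃ δ : ℝ, 0 < δ ∧
      ∀ s ∈ Set.Ico (0 : ℝ) 1, ∀ x ∈ Set.Ioo (0 : ℝ) 1,
        |2 * vtilde s x - vbar s x|
          ≤ |x - x ^ 2 - 1 + s + (1 - s) * Real.log (1 - s)| / 2 + δ * (1 - s) := by
  refine ⟨log 2, log_pos one_lt_two, ?_⟩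
  rintro s ⟨-, hs⟩ x ⟨hx₀, hx₁⟩
  have hs' : 0 < 1 - s := sub_pos.mpr hs
  rw [two_vtilde_sub_vbar_eq hs hx₀ hx₁]
  refine (abs_sub _ _).trans ?_
  rw [abs_div, abs_two, abs_mul, abs_of_pos hs', mul_comm (log 2)]
  gcongr
  exact abs_log_sub_log_sin_le hx₀ hx₁
end
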